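/- Let G = ℝ^{n+1} be a Grushin space of homogeneous dimension Q = n+2 with Q ≥ 3, and let 1 < p < ∞. Then for any u ∈ C_0^∞(ℝ^{n+1} ∖ {o}): ∫_{ℝ^{n+1}} |ln ϱ|^p |∇_{ϱ,G} u|^p / ϱ^{Q−p} dx dt ≥ (1/p^p) ∫_{ℝ^{n+1}} |u|^p ψ^{p/2} / ϱ^{Q} dx dt, and the constant 1/p^p is sharp. -/

import Mathlib

open MeasureTheory Real

noncomputable section

/-- Points of the Grushin space `ℝ^{n+1}`. -/
abbrev GPt (n : ℕ) := EuclideanSpace ℝ (Fin n) × ℝ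

/-- Homogeneous Grushin norm `ϱ(x,t) = (|x|⁴ + 4t²)^{1/4}`. -/
def gNorm {n : ℕ} (z : GPt n) : ℝ := (‖z.1‖ ^ 4 + 4 * z.2 ^ 2) ^ ((1 : ℝ) / 4)

/-- The geometric term `ψ(x,t) = |x|²/ϱ²` (so that `|∇_G ϱ| = ψ^{1/2}`). -/
def gPsi {n : ℕ} (z : GPt n) : ℝ := ‖z.1‖ ^ 2 / gNorm z ^ 2

/-- Radial derivative `∂_ϱ u(x,t) = d/ds u(s·x/ϱ, s²·t/ϱ²)` at `s = ϱ(x,t)`. -/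
def radialDeriv {n : ℕ} (u : GPt n → ℝ) (z : GPt n) : ℝ :=
  deriv (fun s : ℝ => u ((s / gNorm z) • z.1, (s ^ 2 / gNorm z ^ 2) * z.2)) (gNorm z)

/-- The scaled function `u_R(x,t) = u(R·x/ϱ, R²·t/ϱ²)`. -/
def uScaled {n : ℕ} (R : ℝ) (u : GPt n → ℝ) (z : GPt n) : ℝ :=
  u ((R / gNorm z) • z.1, (R ^ 2 / gNorm z ^ 2) * z.2)

/-- Radial Grushin operator `L_{ϱ,G} u = ψ(∂_ϱ² u + ((Q−1)/ϱ) ∂_ϱ u)`. -/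
def radialLap {n : ℕ} (Q : ℝ) (u : GPt n → ℝ) (z : GPt n) : ℝ :=
  gPsi z * (radialDeriv (radialDeriv u) z + (Q - 1) / gNorm z * radialDeriv u z)

/-- The Grushin operator `L_G u = Δ_x u + |x|² ∂_t² u`. -/
def grushinOp {n : ℕ} (u : GPt n → ℝ) (z : GPt n) : ℝ :=
  (∑ i : Fin n,
      deriv (deriv fun s : ℝ => u (z.1 + s • EuclideanSpace.single i (1 : ℝ), z.2)) 0)
    + ‖z.1‖ ^ 2 * deriv (deriv fun s : ℝ => u (z.1, z.2 + s)) 0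

/-- The first-order operator `T_β(u) = ψ^{1/2}(∂_ϱ u + ((Q−β−2)/(2ϱ)) u)`. -/
def Tweight {n : ℕ} (Q β : ℝ) (u : GPt n → ℝ) (z : GPt n) : ℝ :=
  Real.sqrt (gPsi z) * (radialDeriv u z + (Q - β - 2) / (2 * gNorm z) * u z)

/-- The iterated operator `R_{β,k} = T_β ∘ T_{β+2} ∘ ⋯ ∘ T_{β+2k}`. -/
def Rop {n : ℕ} (Q : ℝ) : ℕ → ℝ → (GPt n → ℝ) → GPt n → ℝ
  | 0, β, u => Tweight Q β u
  | k + 1, β, u => Tweight Q β (Rop Q k (β + 2) u)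

/-- The constants `Λ_k(Q,p,β)`. -/
def Lam (Q p β : ℝ) (k : ℕ) : ℝ :=
  if k = 1 then ((Q - p - β) / p) ^ p
  else ((Q * (p - 1) + β + ((k : ℝ) - 2) * p) * (Q - β - (k : ℝ) * p) / p ^ 2) ^ p

/-- The constant `C_{2l,p,β} = ∏_{i=1}^{l} Λ_{2i}(Q,p,β)`. -/
def Ceven (Q p β : ℝ) (l : ℕ) : ℝ := ∏ i ∈ Finset.range l, Lam Q p β (2 * i + 2)

/-- The constant `C_{2l+1,p,β} = ∏_{i=0}^{l} Λ_{2i+1}(Q,p,β)`. -/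
def Codd (Q p β : ℝ) (l : ℕ) : ℝ := ∏ i ∈ Finset.range (l + 1), Lam Q p β (2 * i + 1)

/-- The constant `A_m = ((Q+m)² + (Q−4−m)²)/4`. -/
def Aconst (Q m : ℝ) : ℝ := ((Q + m) ^ 2 + (Q - 4 - m) ^ 2) / 4

/-- The constants `D_{j,m,β}` given by the iteration
`D_{j,m+1,β} = Λ_{2m+2}(Q,2,β) D_{j−2,m,β} + A_{β+4m} D_{j−1,m,β} + D_{j,m,β}`,
with `D_{0,0,β} = 1` (and vanishing off-range values). -/
def Dconst (Q β : ℝ) : ℕ → ℤ → ℝ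
  | 0, j => if j = 0 then 1 else 0
  | m + 1, j =>
      Lam Q 2 β (2 * m + 2) * Dconst Q β m (j - 2)
        + Aconst Q (β + 4 * (m : ℝ)) * Dconst Q β m (j - 1) + Dconst Q β m j

/-- The constants `B_{j,m,β,k}` given by the iteration
`B_{j,m+1,β,k} = Λ_2(Q,2,β+2k+2) B_{j−2,m,β+4,k} + A_{β+2k+2} B_{j−1,m,β+2,k+1} + B_{j,m,β,k+2}`,
with `B_{0,0,β,k} = 1` (and vanishing off-range values). -/
def Bconst (Q : ℝ) : ℕ → ℤ → ℝ → ℝ → ℝ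
  | 0, j, _, _ => if j = 0 then 1 else 0
  | m + 1, j, β, k =>
      Lam Q 2 (β + 2 * k + 2) 2 * Bconst Q m (j - 2) (β + 4) k
        + Aconst Q (β + 2 * k + 2) * Bconst Q m (j - 1) (β + 2) (k + 1)
        + Bconst Q m j β (k + 2)

/-- Surface measure `ω_n` of the unit sphere in `ℝ^n`. -/
def sphSurface (n : ℕ) : ℝ :=
  n * (volume (Metric.ball (0 : EuclideanSpace ℝ (Fin n)) 1)).toReal

/-- The integral constant `C^{Ω,m} = ω_n ∫_0^π (sin φ)^{(n+m)/2} dφ`. -/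
def COmega (n m : ℕ) : ℝ :=
  sphSurface n * ∫ φ in (0 : ℝ)..π, Real.sin φ ^ (((n : ℝ) + (m : ℝ)) / 2)

/-- The sharp Frank–Seiringer constant `c_p = min_{0<t≤1/2} [(1−t)^p − t^p + p t^{p−1}]`. -/
def cFS (p : ℝ) : ℝ :=
  sInf {y : ℝ | ∃ t : ℝ, 0 < t ∧ t ≤ 1 / 2 ∧ y = (1 - t) ^ p - t ^ p + p * t ^ (p - 1)}

/-- Compactly supported smooth test functions with (closed) support inside `s`. -/
def IsTest {n : ℕ} (s : Set (GPt n)) (u : GPt n → ℝ) : Prop :=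
  ContDiff ℝ (⊤ : ℕ∞) u ∧ HasCompactSupport u ∧ tsupport u ⊆ s

/-- A function on the Grushin space is radial if it depends only on the homogeneous norm. -/
def IsRadial {n : ℕ} (u : GPt n → ℝ) : Prop :=
  ∃ f : ℝ → ℝ, ∀ z, u z = f (gNorm z)

/-- The distance function `d_H(u,R)`. -/
def dH {n : ℕ} (Q p β R : ℝ) (u : GPt n → ℝ) : ℝ :=
  (∫ z : GPt n,
      |u z - R ^ ((Q - p - β) / p) * uScaled R u z * gNorm z ^ (-((Q - p - β) / p))| ^ p *
        gPsi z ^ (p / 2) / (|Real.log (R / gNorm z)| ^ p * gNorm z ^ (p + β))) ^ (1 / p)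

/-- The distance function `d_R(u,k,β)`. -/
def dRdist {n : ℕ} (Q p β R : ℝ) (k : ℕ) (u : GPt n → ℝ) : ℝ :=
  (∫ z : GPt n,
      (|u z| ^ ((p - 2) / 2) * u z -
          |uScaled R u z| ^ ((p - 2) / 2) * uScaled R u z *
            (gNorm z / R) ^ (-((Q - (k : ℝ) * p - β) / 2))) ^ 2 *
        gPsi z ^ (p / 2) /
        (gNorm z ^ ((k : ℝ) * p + β) * Real.log (R / gNorm z) ^ 2)) ^ ((1 : ℝ) / 2)

/-- The distance function `d_C(u,R)`. -/
def dCdist {n : ℕ} (Q p R : ℝ) (u : GPt n → ℝ) : ℝ :=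
  (∫ z in {z : GPt n | gNorm z < 1},
      |u z - Real.log (1 / gNorm z) ^ ((p - 1) / p) * R ^ ((p - 1) / p) *
          uScaled (Real.exp (-1 / R)) u z| ^ p *
        gPsi z ^ (p / 2) /
        (gNorm z ^ Q * Real.log (1 / gNorm z) ^ p *
          |Real.log (R * Real.log (1 / gNorm z))| ^ p)) ^ (1 / p)

section GrushinDilations

open Set Filter Topology

variable {n : ℕ}

/-- The Grushin dilation with factor `exp s`. -/
def dil (s : ℝ) (z : GPt n) : GPt n := (exp s • z.1, exp s ^ 2 * z.2)

/-- The weight `ψ^{p/2} ϱ^{-Q}`, homogeneous of degree `-Q`. -/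
def gWeight (p : ℝ) (z : GPt n) : ℝ := gPsi z ^ (p / 2) / gNorm z ^ ((n : ℝ) + 2)

/-- The dilation-invariant measure with density `gWeight p`. -/
def gMeasure (n : ℕ) (p : ℝ) : Measure (GPt n) :=
  volume.withDensity fun z => ENNReal.ofReal (gWeight p z)

/-- The derivative along the dilations, `Eu = ϱ ∂_ϱ u`. -/
def eulerDeriv (u : GPt n → ℝ) (z : GPt n) : ℝ := deriv (fun s => u (dil s z)) 0

lemma gNorm_arg_nonneg (z : GPt n) : 0 ≤ ‖z.1‖ ^ 4 + 4 * z.2 ^ 2 := by positivity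

lemma gNorm_nonneg (z : GPt n) : 0 ≤ gNorm z := rpow_nonneg (gNorm_arg_nonneg z) _

lemma gNorm_zero : gNorm (0 : GPt n) = 0 := by simp [gNorm]

lemma gNorm_pow_four (z : GPt n) : gNorm z ^ 4 = ‖z.1‖ ^ 4 + 4 * z.2 ^ 2 := by
  rw [gNorm, ← rpow_natCast, ← rpow_mul (gNorm_arg_nonneg z)]
  norm_num

lemma gNorm_arg_pos {z : GPt n} (hz : z ≠ 0) : 0 < ‖z.1‖ ^ 4 + 4 * z.2 ^ 2 := by
  by_cases h : z.1 = 0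
  · have h2 : z.2 ≠ 0 := fun h2 => hz (Prod.ext h h2)
    positivity
  · positivity

lemma gNorm_pos {z : GPt n} (hz : z ≠ 0) : 0 < gNorm z := rpow_pos_of_pos (gNorm_arg_pos hz) _

lemma continuous_gNorm : Continuous (gNorm : GPt n → ℝ) :=
  Continuous.rpow_const (by fun_prop) fun _ => Or.inr (by norm_num)

lemma gPsi_nonneg (z : GPt n) : 0 ≤ gPsi z := by unfold gPsi; positivity

lemma gWeight_nonneg (p : ℝ) (z : GPt n) : 0 ≤ gWeight p z :=
  div_nonneg (rpow_nonneg (gPsi_nonneg z) _) (rpow_nonneg (gNorm_nonneg z) _)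

lemma measurable_gWeight (p : ℝ) : Measurable (gWeight p : GPt n → ℝ) := by
  have h := (continuous_gNorm (n := n)).measurable
  unfold gWeight gPsi
  fun_prop

lemma continuousOn_gWeight {p : ℝ} (hp : 0 < p) :
    ContinuousOn (gWeight p : GPt n → ℝ) {z | z ≠ 0} := by
  have h := (continuous_gNorm (n := n)).continuousOn (s := {z | z ≠ 0})
  refine ContinuousOn.div (ContinuousOn.rpow_const ?_ fun _ _ => Or.inr (by positivity))
    (h.rpow_const fun z hz => Or.inl (gNorm_pos hz).ne')
    fun z hz => (rpow_pos_of_pos (gNorm_pos hz) _).ne'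
  exact ContinuousOn.div (by fun_prop) (h.pow 2) fun z hz => (pow_pos (gNorm_pos hz) 2).ne'

lemma dil_zero (z : GPt n) : dil 0 z = z := by simp [dil]

lemma dil_add (s r : ℝ) (z : GPt n) : dil (s + r) z = dil s (dil r z) := by
  simp [dil, exp_add, smul_smul, mul_pow, mul_assoc]

lemma dil_neg_dil (s : ℝ) (z : GPt n) : dil (-s) (dil s z) = z := by
  rw [← dil_add, neg_add_cancel, dil_zero]

lemma dil_ne_zero {s : ℝ} {z : GPt n} (hz : z ≠ 0) : dil s z ≠ 0 := by
  intro h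
  apply hz
  rw [← dil_neg_dil s z, h]
  simp [dil]

lemma continuous_dil : Continuous fun q : ℝ × GPt n => dil q.1 q.2 := by
  unfold dil
  fun_prop

lemma continuous_dil_right (s : ℝ) : Continuous (dil s : GPt n → GPt n) :=
  continuous_dil.comp (by fun_prop : Continuous fun z : GPt n => (s, z))

lemma gNorm_dil (s : ℝ) (z : GPt n) : gNorm (dil s z) = exp s * gNorm z := by
  refine (pow_left_inj₀ (gNorm_nonneg _) (mul_nonneg (exp_pos s).le (gNorm_nonneg _))
    (by norm_num : (4 : ℕ) ≠ 0)).1 ?_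
  rw [mul_pow, gNorm_pow_four, gNorm_pow_four]
  simp only [dil, norm_smul, norm_eq_abs, abs_exp]
  ring

lemma gPsi_dil (s : ℝ) (z : GPt n) : gPsi (dil s z) = gPsi z := by
  rw [gPsi, gPsi, gNorm_dil]
  simp only [dil, norm_smul, norm_eq_abs, abs_exp, mul_pow]
  exact mul_div_mul_left _ _ (pow_pos (exp_pos s) 2).ne'

lemma gWeight_dil (p s : ℝ) (z : GPt n) :
    gWeight p z = exp s ^ (n + 2) * gWeight p (dil s z) := by
  rw [gWeight, gWeight, gPsi_dil, gNorm_dil, mul_rpow (exp_pos s).le (gNorm_nonneg z)]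
  have : exp s ^ ((n : ℝ) + 2) = exp s ^ (n + 2) := by
    rw [← rpow_natCast]
    push_cast
    rfl
  rw [this, ← mul_div_assoc, mul_div_mul_left _ _ (pow_pos (exp_pos s) (n + 2)).ne']

lemma map_dil_volume (s : ℝ) : Measure.map (dil s) (volume : Measure (GPt n)) =
    ENNReal.ofReal ((exp s ^ (n + 2))⁻¹) • volume := by
  have h1 : Measure.map (fun x : EuclideanSpace ℝ (Fin n) => exp s • x) volume =
      ENNReal.ofReal ((exp s ^ n)⁻¹) • volume := by
    rw [Measure.map_addHaar_smul volume (exp_pos s).ne', finrank_euclideanSpace_fin,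
      abs_of_pos (by positivity)]
  have h2 : Measure.map (fun t : ℝ => exp s ^ 2 * t) volume =
      ENNReal.ofReal ((exp s ^ 2)⁻¹) • volume := by
    have := Measure.map_addHaar_smul (volume : Measure ℝ) (pow_pos (exp_pos s) 2).ne'
    rw [Module.finrank_self, pow_one, abs_of_pos (by positivity)] at this
    simpa using this
  have h3 : (dil s : GPt n → GPt n) =
      Prod.map (fun x : EuclideanSpace ℝ (Fin n) => exp s • x) fun t : ℝ => exp s ^ 2 * t := rfl
  rw [h3, Measure.volume_eq_prod, ← Measure.map_prod_map _ _ (by fun_prop) (by fun_prop), h1, h2,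
    Measure.prod_smul_left, Measure.prod_smul_right, smul_smul, ← ENNReal.ofReal_mul (by positivity),
    pow_add, mul_inv]

lemma measurePreserving_dil (p s : ℝ) :
    MeasurePreserving (dil s) (gMeasure n p) (gMeasure n p) := by
  have hm := (continuous_dil_right (n := n) s).measurable
  have hw : Measurable fun z : GPt n => ENNReal.ofReal (gWeight p z) :=
    (measurable_gWeight p).ennreal_ofReal
  refine ⟨hm, Measure.ext_of_lintegral _ fun f hf => ?_⟩
  have hfd : Measurable fun z => f (dil s z) := hf.comp hm
  rw [lintegral_map hf hm, gMeasure, lintegral_withDensity_eq_lintegral_mul _ hw hfd,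
    lintegral_withDensity_eq_lintegral_mul _ hw hf]
  simp only [Pi.mul_apply]
  have hF : Measurable fun z : GPt n => ENNReal.ofReal (gWeight p z) * f z := hw.mul hf
  have hFd : Measurable fun z : GPt n => ENNReal.ofReal (gWeight p (dil s z)) * f (dil s z) :=
    hF.comp hm
  calc ∫⁻ z : GPt n, ENNReal.ofReal (gWeight p z) * f (dil s z)
      = ∫⁻ z : GPt n, ENNReal.ofReal (exp s ^ (n + 2)) *
        (ENNReal.ofReal (gWeight p (dil s z)) * f (dil s z)) := lintegral_congr fun z => by
        rw [gWeight_dil p s z, ENNReal.ofReal_mul (by positivity), mul_assoc]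
    _ = ENNReal.ofReal (exp s ^ (n + 2)) *
        ∫⁻ z, ENNReal.ofReal (gWeight p z) * f z ∂(Measure.map (dil s) volume) := by
      rw [lintegral_const_mul _ hFd, lintegral_map hF hm]
    _ = _ := by
      rw [map_dil_volume, lintegral_smul_measure, smul_eq_mul, ← mul_assoc,
        ← ENNReal.ofReal_mul (by positivity), mul_inv_cancel₀ (by positivity), ENNReal.ofReal_one,
        one_mul]

lemma integral_gMeasure (p : ℝ) (g : GPt n → ℝ) :
    ∫ z, g z ∂gMeasure n p = ∫ z, gWeight p z * g z := by
  rw [gMeasure, integral_withDensity_eq_integral_toReal_smul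
    (measurable_gWeight p).ennreal_ofReal (ae_of_all _ fun _ => ENNReal.ofReal_lt_top)]
  simp [ENNReal.toReal_ofReal (gWeight_nonneg p _)]

lemma gMeasure_lt_top {p : ℝ} (hp : 0 < p) {K : Set (GPt n)} (hK : IsCompact K)
    (h0 : K ⊆ {z | z ≠ 0}) : gMeasure n p K < ⊤ := by
  rw [gMeasure, withDensity_apply _ hK.measurableSet]
  exact (((continuousOn_gWeight hp).mono h0).integrableOn_compact hK).lintegral_lt_top

lemma integrable_gMeasure {p : ℝ} (hp : 0 < p) {K : Set (GPt n)} (hK : IsCompact K)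
    (h0 : K ⊆ {z | z ≠ 0}) {g : GPt n → ℝ} (hg : Continuous g) (hs : ∀ z ∉ K, g z = 0) :
    Integrable g (gMeasure n p) := by
  rw [← integrableOn_iff_integrable_of_support_subset (s := K)
    fun z hz => by_contra fun h => hz (hs z h)]
  obtain ⟨M, hM⟩ := hK.exists_bound_of_continuousOn hg.continuousOn
  exact Measure.integrableOn_of_bounded (gMeasure_lt_top hp hK h0).ne hg.aestronglyMeasurable
    ((ae_restrict_iff' hK.measurableSet).2 (ae_of_all _ hM))

lemma hasDerivAt_dil (s : ℝ) (z : GPt n) :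
    HasDerivAt (fun s => dil s z) ((dil s z).1, 2 * (dil s z).2) s := by
  refine HasDerivAt.prodMk ((hasDerivAt_exp s).smul_const z.1) ?_
  refine (((hasDerivAt_exp s).pow 2).mul_const z.2).congr_deriv ?_
  change _ = 2 * (exp s ^ 2 * z.2)
  push_cast
  ring

lemma hasDerivAt_comp_dil {f : GPt n → ℝ} (hf : Differentiable ℝ f) (s : ℝ) (z : GPt n) :
    HasDerivAt (fun s => f (dil s z)) (eulerDeriv f (dil s z)) s := by
  have key (s : ℝ) (z : GPt n) : HasDerivAt (fun s => f (dil s z))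
      (fderiv ℝ f (dil s z) ((dil s z).1, 2 * (dil s z).2)) s :=
    (hf _).hasFDerivAt.comp_hasDerivAt s (hasDerivAt_dil s z)
  convert key s z using 1
  rw [eulerDeriv, (key 0 (dil s z)).deriv, dil_zero]

lemma eulerDeriv_eq {f : GPt n → ℝ} (hf : Differentiable ℝ f) (z : GPt n) :
    eulerDeriv f z = fderiv ℝ f z (z.1, 2 * z.2) := by
  have h := (hf (dil 0 z)).hasFDerivAt.comp_hasDerivAt 0 (hasDerivAt_dil 0 z)
  rw [dil_zero] at h
  exact h.deriv

lemma continuous_eulerDeriv {f : GPt n → ℝ} (hf : ContDiff ℝ 1 f) :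
    Continuous (eulerDeriv f) := by
  have h : eulerDeriv f = fun z => fderiv ℝ f z (z.1, 2 * z.2) :=
    funext (eulerDeriv_eq (hf.differentiable one_ne_zero))
  rw [h]
  exact (hf.continuous_fderiv one_ne_zero).clm_apply (by fun_prop)

lemma eulerDeriv_eq_zero {f : GPt n → ℝ} (hf : Differentiable ℝ f) {z : GPt n}
    (hz : z ∉ tsupport f) : eulerDeriv f z = 0 := by
  rw [eulerDeriv_eq hf, image_eq_zero_of_notMem_tsupport fun h => hz (tsupport_fderiv_subset ℝ h)]
  rfl

lemma integral_eulerDeriv {p : ℝ} (hp : 0 < p) {f : GPt n → ℝ} (hf : ContDiff ℝ 1 f)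
    (hc : HasCompactSupport f) (h0 : tsupport f ⊆ {z | z ≠ 0}) :
    ∫ z, eulerDeriv f z ∂gMeasure n p = 0 := by
  have hd : Differentiable ℝ f := hf.differentiable one_ne_zero
  have hE := continuous_eulerDeriv hf
  set K : Set (GPt n) := (fun q : ℝ × GPt n => dil q.1 q.2) '' (Icc (-1) 1 ×ˢ tsupport f) with hK
  have hKc : IsCompact K := (isCompact_Icc.prod hc).image continuous_dil
  have hK0 : K ⊆ {z | z ≠ 0} := by
    rintro _ ⟨q, hq, rfl⟩
    exact dil_ne_zero (h0 hq.2)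
  obtain ⟨M, hM⟩ : ∃ M, ∀ z, ‖eulerDeriv f z‖ ≤ M :=
    hE.bounded_above_of_compact_support
      (HasCompactSupport.intro hc fun z hz => eulerDeriv_eq_zero hd hz)
  have hlog : Integrable f (gMeasure n p) :=
    integrable_gMeasure hp hc h0 hf.continuous fun z => image_eq_zero_of_notMem_tsupport
  have hder := (hasDerivAt_integral_of_dominated_loc_of_deriv_le (μ := gMeasure n p)
    (F := fun s z => f (dil s z)) (F' := fun s z => eulerDeriv f (dil s z)) (x₀ := 0)
    (s := Icc (-1) 1) (bound := K.indicator fun _ => M)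
    (Icc_mem_nhds (by norm_num) (by norm_num))
    (Eventually.of_forall fun s =>
      (hf.continuous.comp (continuous_dil_right s)).aestronglyMeasurable)
    (by simpa only [dil_zero] using hlog)
    (hE.comp (continuous_dil_right 0)).aestronglyMeasurable
    (ae_of_all _ fun z s hs => ?_) ?_
    (ae_of_all _ fun z s _ => hasDerivAt_comp_dil hd s z)).2
  · have hconst : (fun s => ∫ z, f (dil s z) ∂gMeasure n p) =
        fun _ => ∫ z, f z ∂gMeasure n p := funext fun s => by
      have h := measurePreserving_dil (n := n) p s
      conv_rhs => rw [← h.map_eq]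
      rw [integral_map h.measurable.aemeasurable hf.continuous.aestronglyMeasurable]
    rw [hconst] at hder
    simpa only [dil_zero] using hder.unique (hasDerivAt_const (0 : ℝ) _)
  · by_cases hz : dil s z ∈ tsupport f
    · rw [indicator_of_mem]
      · exact hM _
      · exact ⟨(-s, dil s z), ⟨⟨by linarith [hs.2], by linarith [hs.1]⟩, hz⟩, dil_neg_dil s z⟩
    · rw [eulerDeriv_eq_zero hd hz, norm_zero]
      exact indicator_nonneg (fun _ _ => (norm_nonneg _).trans (hM 0)) z
  · exact (integrable_indicator_iff hKc.measurableSet).2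
      (integrableOn_const (gMeasure_lt_top hp hKc hK0).ne)

lemma radialDeriv_eq {u : GPt n → ℝ} (hu : Differentiable ℝ u) {z : GPt n} (hz : z ≠ 0) :
    radialDeriv u z = eulerDeriv u z / gNorm z := by
  have hρ := (gNorm_pos hz).ne'
  have h1 : HasDerivAt (fun s : ℝ => (s / gNorm z) • z.1) ((1 / gNorm z) • z.1) (gNorm z) :=
    ((hasDerivAt_id _).div_const _).smul_const z.1
  have h2 : HasDerivAt (fun s : ℝ => s ^ 2 / gNorm z ^ 2 * z.2) (1 / gNorm z * (2 * z.2))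
      (gNorm z) := by
    refine ((((hasDerivAt_id (gNorm z)).pow 2).div_const (gNorm z ^ 2)).mul_const z.2).congr_deriv ?_
    simp only [id]
    field_simp
    norm_num
    ring
  have hpt : ((gNorm z / gNorm z) • z.1, gNorm z ^ 2 / gNorm z ^ 2 * z.2) = z := by
    rw [div_self hρ, div_self (pow_ne_zero 2 hρ), one_smul, one_mul]
  have h3 : HasFDerivAt u (fderiv ℝ u z)
      ((gNorm z / gNorm z) • z.1, gNorm z ^ 2 / gNorm z ^ 2 * z.2) := by
    rw [hpt]
    exact (hu z).hasFDerivAt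
  have h4 : ((1 / gNorm z) • z.1, 1 / gNorm z * (2 * z.2)) =
      (1 / gNorm z) • ((z.1, 2 * z.2) : GPt n) := rfl
  have h5 : HasDerivAt (fun s : ℝ => u ((s / gNorm z) • z.1, s ^ 2 / gNorm z ^ 2 * z.2))
      (fderiv ℝ u z ((1 / gNorm z) • z.1, 1 / gNorm z * (2 * z.2))) (gNorm z) :=
    h3.comp_hasDerivAt (gNorm z) (h1.prodMk h2)
  rw [radialDeriv, h5.deriv, h4, map_smul, eulerDeriv_eq hu, smul_eq_mul]
  ring

lemma gWeight_zero {p : ℝ} (hp : 0 < p) : gWeight p (0 : GPt n) = 0 := by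
  simp [gWeight, gPsi, zero_rpow (half_pos hp).ne']

lemma integral_radialDeriv {p : ℝ} (hp : 0 < p) {u : GPt n → ℝ} (hu : Differentiable ℝ u) :
    ∫ z : GPt n, |log (gNorm z)| ^ p * (gPsi z ^ (p / 2) * |radialDeriv u z| ^ p) /
      gNorm z ^ ((n : ℝ) + 2 - p) = ∫ z, |log (gNorm z) * eulerDeriv u z| ^ p ∂gMeasure n p := by
  rw [integral_gMeasure]
  congr 1 with z
  by_cases hz : z = 0
  · simp [hz, gWeight_zero hp, gPsi, zero_rpow (half_pos hp).ne']
  · have hρ := gNorm_pos hz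
    have h1 := (rpow_pos_of_pos hρ p).ne'
    have h2 := (rpow_pos_of_pos hρ ((n : ℝ) + 2)).ne'
    rw [radialDeriv_eq hu hz, abs_div, abs_of_pos hρ, div_rpow (abs_nonneg _) hρ.le,
      rpow_sub hρ, abs_mul, mul_rpow (abs_nonneg _) (abs_nonneg _), gWeight]
    field_simp

lemma log_gNorm (z : GPt n) : log (gNorm z) = 1 / 4 * log (‖z.1‖ ^ 4 + 4 * z.2 ^ 2) := by
  by_cases hz : z = 0
  · simp [hz, gNorm]
  · rw [gNorm, log_rpow (gNorm_arg_pos hz)]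

lemma contDiffAt_log_gNorm {k : WithTop ℕ∞} {z : GPt n} (hz : z ≠ 0) :
    ContDiffAt ℝ k (fun z : GPt n => log (gNorm z)) z := by
  simp_rw [log_gNorm]
  have h : ContDiff ℝ k fun z : GPt n => ‖z.1‖ ^ 4 + 4 * z.2 ^ 2 := by
    have h4 : (fun z : GPt n => ‖z.1‖ ^ 4 + 4 * z.2 ^ 2) =
        fun z : GPt n => (‖z.1‖ ^ 2) ^ 2 + 4 * z.2 ^ 2 := by
      ext z
      ring
    rw [h4]
    exact ((contDiff_fst.norm_sq ℝ).pow 2).add (contDiff_const.mul (contDiff_snd.pow 2))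
  exact contDiffAt_const.mul (h.contDiffAt.log (gNorm_arg_pos hz).ne')

lemma contDiff_mul_log_gNorm {k : WithTop ℕ∞} {g : GPt n → ℝ} (hg : ContDiff ℝ k g)
    (h0 : tsupport g ⊆ {z | z ≠ 0}) : ContDiff ℝ k fun z => g z * log (gNorm z) := by
  rw [contDiff_iff_contDiffAt]
  intro z
  by_cases hz : z ∈ tsupport g
  · exact hg.contDiffAt.mul (contDiffAt_log_gNorm (h0 hz))
  · refine (contDiffAt_const (c := (0 : ℝ))).congr_of_eventuallyEq ?_
    filter_upwards [notMem_tsupport_iff_eventuallyEq.1 hz] with y hy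
    rw [hy, Pi.zero_apply, zero_mul]

lemma log_gNorm_dil (s : ℝ) {z : GPt n} (hz : z ≠ 0) :
    log (gNorm (dil s z)) = s + log (gNorm z) := by
  rw [gNorm_dil, log_mul (exp_pos s).ne' (gNorm_pos hz).ne', log_exp]

lemma young_hardy {p : ℝ} (hp : 1 < p) (a e l : ℝ) :
    -(p * |a| ^ (p - 2) * a * e * l) ≤ p ^ p / p * |l * e| ^ p + (1 - 1 / p) * |a| ^ p := by
  have hp0 : 0 < p := by linarith
  have hpq := HolderConjugate.conjExponent hp
  have hq : 1 - 1 / p = 1 / p.conjExponent := by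
    have := hpq.inv_add_inv_eq_one
    rw [one_div, one_div]
    linarith
  have ha : |a| ^ (p - 2) * |a| = |a| ^ (p - 1) := by
    rcases eq_or_ne a 0 with rfl | h
    · simp [zero_rpow (sub_pos.2 hp).ne']
    · rw [← rpow_add_one (abs_pos.2 h).ne']
      ring_nf
  have hb : (|a| ^ (p - 1)) ^ p.conjExponent = |a| ^ p := by
    rw [← rpow_mul (abs_nonneg a), conjExponent, mul_div_cancel₀ _ (sub_pos.2 hp).ne']
  calc -(p * |a| ^ (p - 2) * a * e * l) ≤ |p * |a| ^ (p - 2) * a * e * l| := neg_le_abs _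
    _ = p * |l * e| * |a| ^ (p - 1) := by
      rw [← ha]
      simp only [abs_mul, abs_of_pos hp0, abs_of_nonneg (rpow_nonneg (abs_nonneg a) _)]
      ring
    _ ≤ (p * |l * e|) ^ p / p + (|a| ^ (p - 1)) ^ p.conjExponent / p.conjExponent :=
      young_inequality_of_nonneg (by positivity) (by positivity) hpq
    _ = _ := by
      rw [hb, hq, mul_rpow hp0.le (abs_nonneg _)]
      ring

lemma hardy_eulerDeriv {p : ℝ} (hp : 1 < p) {u : GPt n → ℝ} (hu : ContDiff ℝ 1 u)
    (hc : HasCompactSupport u) (h0 : tsupport u ⊆ {z | z ≠ 0}) :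
    ∫ z, |u z| ^ p ∂gMeasure n p ≤
      p ^ p * ∫ z, |log (gNorm z) * eulerDeriv u z| ^ p ∂gMeasure n p := by
  have hp0 : 0 < p := by linarith
  have hud : Differentiable ℝ u := hu.differentiable one_ne_zero
  set A : GPt n → ℝ := fun z => |u z| ^ p with hA
  set B : GPt n → ℝ := fun z => |log (gNorm z) * eulerDeriv u z| ^ p with hB
  set f : GPt n → ℝ := fun z => A z * log (gNorm z) with hf
  have hAz : ∀ z ∉ tsupport u, A z = 0 := fun z hz => by
    simp [hA, image_eq_zero_of_notMem_tsupport hz, zero_rpow hp0.ne']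
  have hA1 : ContDiff ℝ 1 A := hu.norm_rpow hp
  have hAs : tsupport A ⊆ tsupport u :=
    closure_minimal (fun z hz => by_contra fun h => hz (hAz z h)) (isClosed_tsupport u)
  have hEs : tsupport (eulerDeriv u) ⊆ tsupport u :=
    closure_minimal (fun z hz => by_contra fun h => hz (eulerDeriv_eq_zero hud h))
      (isClosed_tsupport u)
  have hf1 : ContDiff ℝ 1 f := contDiff_mul_log_gNorm hA1 (hAs.trans h0)
  have hfz : ∀ z ∉ tsupport u, f z = 0 := fun z hz => by simp [hf, hAz z hz]
  have hfs : tsupport f ⊆ tsupport u :=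
    closure_minimal (fun z hz => by_contra fun h => hz (hfz z h)) (isClosed_tsupport u)
  have hfc : HasCompactSupport f := HasCompactSupport.intro hc hfz
  have hBc : Continuous B := by
    have h := (contDiff_mul_log_gNorm (contDiff_zero.2 (continuous_eulerDeriv hu))
      (hEs.trans h0)).continuous
    simp only [hB, mul_comm (log _)]
    exact h.abs.rpow_const fun _ => Or.inr hp0.le
  have hBi : Integrable B (gMeasure n p) := integrable_gMeasure hp0 hc h0 hBc fun z hz => by
    simp [hB, eulerDeriv_eq_zero hud hz, zero_rpow hp0.ne']
  have hAi : Integrable A (gMeasure n p) := integrable_gMeasure hp0 hc h0 hA1.continuous hAz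
  have hfi : Integrable (eulerDeriv f) (gMeasure n p) :=
    integrable_gMeasure hp0 hc h0 (continuous_eulerDeriv hf1) fun z hz =>
      eulerDeriv_eq_zero (hf1.differentiable one_ne_zero) fun h => hz (hfs h)
  have hfE : ∀ z, eulerDeriv f z =
      p * |u z| ^ (p - 2) * u z * eulerDeriv u z * log (gNorm z) + A z := fun z => by
    by_cases hz : z = 0
    · have hz' : z ∉ tsupport u := fun h => h0 h hz
      rw [eulerDeriv_eq_zero (hf1.differentiable one_ne_zero) fun h => hz' (hfs h), hAz z hz',
        image_eq_zero_of_notMem_tsupport hz']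
      ring
    · have h1 := (hasDerivAt_abs_rpow (u (dil 0 z)) hp).comp 0 (hasDerivAt_comp_dil hud 0 z)
      have h2 := h1.mul ((hasDerivAt_id (0 : ℝ)).add_const (log (gNorm z)))
      have h3 : (fun s => f (dil s z)) = ((fun x : ℝ => |x| ^ p) ∘ fun s => u (dil s z)) *
          fun s => id s + log (gNorm z) := by
        ext s
        simp only [hf, hA, log_gNorm_dil s hz]
        rfl
      rw [eulerDeriv, h3, h2.deriv]
      simp [dil_zero, hA]
  have hle : ∫ z, A z ∂gMeasure n p ≤
      ∫ z, (eulerDeriv f z + p ^ p / p * B z + (1 - 1 / p) * A z) ∂gMeasure n p := by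
    refine integral_mono hAi ((hfi.add (hBi.const_mul _)).add (hAi.const_mul _)) fun z => ?_
    have := young_hardy hp (u z) (eulerDeriv u z) (log (gNorm z))
    simp only [hfE z]
    linarith
  have hsum : Integrable (fun z => eulerDeriv f z + p ^ p / p * B z) (gMeasure n p) :=
    hfi.add (hBi.const_mul _)
  rw [integral_add hsum (hAi.const_mul _), integral_add hfi (hBi.const_mul _),
    integral_const_mul, integral_const_mul, integral_eulerDeriv hp0 hf1 hfc (hfs.trans h0)] at hle
  have h5 : 1 / p * ∫ z, A z ∂gMeasure n p ≤ 1 / p * (p ^ p * ∫ z, B z ∂gMeasure n p) := by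
    linarith [show p ^ p / p * ∫ z, B z ∂gMeasure n p =
      1 / p * (p ^ p * ∫ z, B z ∂gMeasure n p) by ring]
  exact le_of_mul_le_mul_left h5 (by positivity)

lemma isCompact_gNorm_le (M : ℝ) : IsCompact {z : GPt n | gNorm z ≤ M} := by
  refine (isCompact_closedBall (0 : GPt n) (max M (M ^ 2))).of_isClosed_subset
    (isClosed_le continuous_gNorm continuous_const) fun z (hz : gNorm z ≤ M) => ?_
  have h4 : ‖z.1‖ ^ 4 + 4 * z.2 ^ 2 ≤ M ^ 4 := by
    rw [← gNorm_pow_four]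
    exact pow_le_pow_left₀ (gNorm_nonneg z) hz 4
  rw [mem_closedBall_zero_iff, Prod.norm_def]
  refine max_le_max ?_ ?_
  · refine le_of_pow_le_pow_left₀ (by norm_num : (4 : ℕ) ≠ 0) ((gNorm_nonneg z).trans hz) ?_
    nlinarith [sq_nonneg z.2]
  · rw [norm_eq_abs]
    refine abs_le_of_sq_le_sq ?_ (sq_nonneg M)
    nlinarith [sq_nonneg z.2, pow_nonneg (norm_nonneg z.1) 4]

lemma measurable_log_gNorm : Measurable fun z : GPt n => log (gNorm z) :=
  measurable_log.comp continuous_gNorm.measurable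

lemma gMeasure_singleton_zero (p : ℝ) (hp : 0 < p) : gMeasure n p {0} = 0 := by
  rw [gMeasure, withDensity_apply _ (measurableSet_singleton _), setLIntegral_eq_zero_iff
    (measurableSet_singleton _) (measurable_gWeight p).ennreal_ofReal]
  refine ae_of_all _ fun z hz => ?_
  rw [mem_singleton_iff.1 hz, gWeight_zero hp, ENNReal.ofReal_zero]

lemma gMeasure_ne_zero (hn : 1 ≤ n) (p : ℝ) : gMeasure n p ≠ 0 := by
  intro h
  rw [gMeasure, withDensity_eq_zero_iff (measurable_gWeight p).ennreal_ofReal.aemeasurable] at h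
  have hU : IsOpen {z : GPt n | z.1 ≠ 0} :=
    isOpen_compl_singleton.preimage (continuous_fst : Continuous fun z : GPt n => z.1)
  have hne : {z : GPt n | z.1 ≠ 0}.Nonempty :=
    ⟨(EuclideanSpace.single ⟨0, hn⟩ 1, 0), by simp⟩
  refine (hU.measure_pos volume hne).ne' (measure_mono_null (fun z hz => ?_) (ae_iff.1 h))
  have hz' : z ≠ 0 := fun h0 => hz (by rw [h0]; rfl)
  have hρ := gNorm_pos hz'
  have hx : 0 < ‖z.1‖ := norm_pos_iff.2 hz
  have : 0 < gWeight p z := by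
    unfold gWeight gPsi
    positivity
  simpa using this

lemma exists_integral_log_gNorm (hn : 1 ≤ n) {p : ℝ} (hp : 0 < p) :
    ∃ c : ℝ, 0 < c ∧ ∀ G : ℝ → ℝ, Measurable G →
      ∫ z, G (log (gNorm z)) ∂gMeasure n p = c * ∫ s, G s := by
  set μ : Measure ℝ := Measure.map (fun z => log (gNorm z)) (gMeasure n p) with hμ
  have hL := measurable_log_gNorm (n := n)
  have hinv : μ.IsAddLeftInvariant := ⟨fun s => by
    rw [hμ, Measure.map_map (measurable_const_add s) hL]
    have h1 : (fun x => s + x) ∘ (fun z : GPt n => log (gNorm z)) =ᵐ[gMeasure n p]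
        fun z => log (gNorm (dil s z)) := by
      filter_upwards [compl_mem_ae_iff.2 (gMeasure_singleton_zero p hp)] with z hz
      exact (log_gNorm_dil s hz).symm
    have h2 := measurePreserving_dil (n := n) p s
    conv_rhs => rw [← h2.map_eq]
    rw [Measure.map_congr h1, Measure.map_map hL h2.measurable]
    rfl⟩
  have hfin : IsFiniteMeasureOnCompacts μ := ⟨fun K hK => by
    obtain ⟨R, hR⟩ := hK.isBounded.subset_closedBall 0
    rw [hμ, Measure.map_apply hL hK.measurableSet]
    have hsub : (fun z : GPt n => log (gNorm z)) ⁻¹' K ⊆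
        {0} ∪ ({z | gNorm z ≤ exp R} ∩ {z | exp (-R) ≤ gNorm z}) := fun z hz => by
      by_cases h0 : z = 0
      · exact Or.inl h0
      · have h1 := mem_closedBall_zero_iff.1 (hR hz)
        rw [norm_eq_abs, abs_le] at h1
        exact Or.inr ⟨(log_le_iff_le_exp (gNorm_pos h0)).1 h1.2,
          (le_log_iff_exp_le (gNorm_pos h0)).1 h1.1⟩
    refine (measure_mono hsub).trans_lt ((measure_union_le _ _).trans_lt ?_)
    rw [gMeasure_singleton_zero p hp, zero_add]
    refine gMeasure_lt_top hp ((isCompact_gNorm_le _).inter_right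
      (isClosed_le continuous_const continuous_gNorm)) ?_
    rintro z ⟨-, hz⟩ rfl
    rw [mem_ofPred_eq, gNorm_zero] at hz
    exact absurd hz (not_le.2 (exp_pos _))⟩
  have heq := Measure.isAddLeftInvariant_eq_smul μ (volume : Measure ℝ)
  refine ⟨Measure.addHaarScalarFactor μ volume, ?_, fun G hG => ?_⟩
  · refine NNReal.coe_pos.2 (pos_iff_ne_zero.2 fun h => gMeasure_ne_zero (n := n) hn p ?_)
    rw [h, zero_smul] at heq
    exact (Measure.map_eq_zero_iff hL.aemeasurable).1 heq
  · rw [← integral_map hL.aemeasurable hG.aestronglyMeasurable, ← hμ]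
    conv_lhs => rw [heq]
    rw [integral_smul_nnreal_measure]
    rfl

lemma integral_comp_log_of_pos (k : ℝ → ℝ) :
    ∫ s, (if 0 < s then k (log s) else 0) = ∫ r, exp r * k r := by
  have h := integral_image_eq_integral_abs_deriv_smul MeasurableSet.univ
    (fun x _ => (hasDerivAt_exp x).hasDerivWithinAt) exp_injective.injOn fun s => k (log s)
  rw [image_univ, range_exp, setIntegral_univ] at h
  simp only [abs_exp, log_exp, smul_eq_mul] at h
  rw [← h, ← integral_indicator measurableSet_Ioi]
  rfl

/-- The radial function equal to `η (log (log ϱ))` for `1 < ϱ` and `0` for `ϱ ≤ 1`. -/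
def logLogRadial (η : ℝ → ℝ) (z : GPt n) : ℝ :=
  if 0 < log (gNorm z) then η (log (log (gNorm z))) else 0

lemma logLogRadial_eq_zero_of_lt {η : ℝ → ℝ} {R : ℝ} (hR : ∀ r, R < |r| → η r = 0) {z : GPt n}
    (hz : gNorm z < exp (exp (-R))) : logLogRadial η z = 0 := by
  rw [logLogRadial]
  split_ifs with h
  · have hρ : 0 < gNorm z := (gNorm_nonneg z).lt_of_ne' fun h0 => by simp [h0] at h
    have h1 := (log_lt_iff_lt_exp h).2 ((log_lt_iff_lt_exp hρ).2 hz)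
    exact hR _ (by linarith [neg_le_abs (log (log (gNorm z)))])
  · rfl

lemma logLogRadial_eventuallyEq_zero {η : ℝ → ℝ} {R : ℝ} (hR : ∀ r, R < |r| → η r = 0)
    {z : GPt n} (hz : ¬ 0 < log (gNorm z)) : logLogRadial η =ᶠ[𝓝 z] 0 := by
  have h1 : gNorm z < exp (exp (-R)) :=
    ((log_nonpos_iff (gNorm_nonneg z)).1 (not_lt.1 hz)).trans_lt (one_lt_exp_iff.2 (exp_pos _))
  filter_upwards [(isOpen_lt continuous_gNorm continuous_const).mem_nhds h1] with y hy
  exact logLogRadial_eq_zero_of_lt hR hy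

lemma ne_zero_of_log_gNorm_pos {z : GPt n} (hz : 0 < log (gNorm z)) : z ≠ 0 := by
  rintro rfl
  simp [gNorm_zero] at hz

lemma isTest_logLogRadial {η : ℝ → ℝ} {R : ℝ} (hη : ContDiff ℝ (⊤ : ℕ∞) η)
    (hR : ∀ r, R < |r| → η r = 0) : IsTest {z : GPt n | z ≠ 0} (logLogRadial η) := by
  refine ⟨contDiff_iff_contDiffAt.2 fun z => ?_,
    HasCompactSupport.intro (isCompact_gNorm_le (exp (exp R))) fun z hz => ?_, fun z hz => ?_⟩
  · by_cases h : 0 < log (gNorm z)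
    · have hL := contDiffAt_log_gNorm (k := (⊤ : ℕ∞)) (ne_zero_of_log_gNorm_pos h)
      refine (hη.contDiffAt.comp z (hL.log h.ne')).congr_of_eventuallyEq ?_
      filter_upwards [hL.continuousAt.eventually_const_lt h] with y hy
      rw [logLogRadial, if_pos hy]
      rfl
    · exact contDiffAt_const.congr_of_eventuallyEq (logLogRadial_eventuallyEq_zero hR h)
  · rw [logLogRadial]
    split_ifs with h
    · have hρ := gNorm_pos (ne_zero_of_log_gNorm_pos h)
      have h1 := (lt_log_iff_exp_lt h).2 ((lt_log_iff_exp_lt hρ).2 (not_le.1 hz))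
      exact hR _ (h1.trans_le (le_abs_self _))
    · rfl
  · rintro rfl
    exact notMem_tsupport_iff_eventuallyEq.2
      (logLogRadial_eventuallyEq_zero hR (by simp [gNorm_zero])) hz

lemma log_mul_eulerDeriv_logLogRadial {η : ℝ → ℝ} {R : ℝ} (hη : Differentiable ℝ η)
    (hR : ∀ r, R < |r| → η r = 0) (z : GPt n) :
    log (gNorm z) * eulerDeriv (logLogRadial η) z =
      if 0 < log (gNorm z) then deriv η (log (log (gNorm z))) else 0 := by
  split_ifs with h
  · have hz := ne_zero_of_log_gNorm_pos h
    have h1 : (fun s => logLogRadial η (dil s z)) =ᶠ[𝓝 0]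
        fun s => η (log (s + log (gNorm z))) := by
      filter_upwards [lt_mem_nhds (neg_lt_zero.2 h)] with s hs
      rw [logLogRadial, log_gNorm_dil s hz, if_pos (by linarith)]
    have h2 : HasDerivAt (fun s => log (s + log (gNorm z))) (1 / (0 + log (gNorm z))) 0 :=
      ((hasDerivAt_id (0 : ℝ)).add_const _).log (by simpa using h.ne')
    have h3 := (hη _).hasDerivAt.comp 0 h2
    rw [eulerDeriv, h1.deriv_eq]
    erw [h3.deriv]
    rw [zero_add]
    field_simp
  · have h1 : (fun s => logLogRadial η (dil s z)) =ᶠ[𝓝 0] fun _ => 0 := by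
      have h2 : Tendsto (fun s => dil s z) (𝓝 0) (𝓝 z) := by
        simpa only [dil_zero] using (hasDerivAt_dil 0 z).continuousAt.tendsto
      exact h2.eventually (logLogRadial_eventuallyEq_zero hR h)
    rw [eulerDeriv, h1.deriv_eq, deriv_const, mul_zero]

lemma integral_abs_rpow_logLog (hn : 1 ≤ n) {p : ℝ} (hp : 0 < p) :
    ∃ c : ℝ, 0 < c ∧ ∀ h : ℝ → ℝ, Measurable h →
      ∫ z, |if 0 < log (gNorm z) then h (log (log (gNorm z))) else 0| ^ p ∂gMeasure n p =
        c * ∫ r, exp r * |h r| ^ p := by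
  obtain ⟨c, hc, H⟩ := exists_integral_log_gNorm hn hp
  refine ⟨c, hc, fun h hh => ?_⟩
  have hG : Measurable fun s => |if 0 < s then h (log s) else 0| ^ p :=
    (Measurable.ite measurableSet_Ioi (hh.comp measurable_log) measurable_const).abs.pow_const p
  rw [H _ hG, ← integral_comp_log_of_pos]
  congr 2 with s
  split_ifs <;> simp [zero_rpow hp.ne']

end GrushinDilations

section WeightedLine

open Set Filter Topology

lemma le_of_weighted_line_hardy {p κ : ℝ} (hp : 1 < p)
    (H : ∀ η : ℝ → ℝ, ContDiff ℝ (⊤ : ℕ∞) η → HasCompactSupport η →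
      κ * ∫ r, exp r * |η r| ^ p ≤ ∫ r, exp r * |deriv η r| ^ p) : κ ≤ 1 / p ^ p := by
  have hp0 : 0 < p := by linarith
  let χ : ContDiffBump (0 : ℝ) := ⟨1, 2, one_pos, one_lt_two⟩
  have hχ : ContDiff ℝ (⊤ : ℕ∞) χ := χ.contDiff
  have hχd : ∀ r, HasDerivAt χ (deriv χ r) r := fun r =>
    (hχ.differentiable (by simp) r).hasDerivAt
  have hχ'c : Continuous (deriv χ) := hχ.continuous_deriv (by simp)
  set J : ℝ → ℝ := fun ε => ∫ r, |-(1 / p) * χ r + ε * deriv χ r| ^ p with hJ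
  set I : ℝ := ∫ r, |χ r| ^ p with hI
  have key : ∀ ε, 0 < ε → κ * I ≤ J ε := fun ε hε => by
    set η : ℝ → ℝ := fun r => exp (-(1 / p) * r) * χ (ε * r) with hη
    have hη1 : ContDiff ℝ (⊤ : ℕ∞) η :=
      (contDiff_exp.comp (contDiff_const.mul contDiff_id)).mul
        (hχ.comp (contDiff_const.mul contDiff_id))
    have hη2 : HasCompactSupport η :=
      (χ.hasCompactSupport.comp_homeomorph (Homeomorph.mulLeft₀ ε hε.ne')).mul_left
    have hη' : ∀ r, deriv η r =
        exp (-(1 / p) * r) * (-(1 / p) * χ (ε * r) + ε * deriv χ (ε * r)) := fun r => by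
      have h1 : HasDerivAt (fun r => exp (-(1 / p) * r)) (exp (-(1 / p) * r) * (-(1 / p) * 1)) r :=
        ((hasDerivAt_id r).const_mul _).exp
      have h2 : HasDerivAt (fun r => χ (ε * r)) (deriv χ (ε * r) * (ε * 1)) r :=
        (hχd (ε * r)).comp r ((hasDerivAt_id r).const_mul ε)
      have h3 : HasDerivAt η (exp (-(1 / p) * r) * (-(1 / p) * 1) * χ (ε * r) +
          exp (-(1 / p) * r) * (deriv χ (ε * r) * (ε * 1))) r := h1.mul h2
      rw [h3.deriv]
      ring
    have hexp : ∀ r a : ℝ, exp r * |exp (-(1 / p) * r) * a| ^ p = |a| ^ p := fun r a => by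
      rw [abs_mul, abs_exp, mul_rpow (exp_pos _).le (abs_nonneg _), ← exp_mul, ← mul_assoc,
        ← exp_add]
      have : r + -(1 / p) * r * p = 0 := by
        field_simp
        ring
      rw [this, exp_zero, one_mul]
    have h := H η hη1 hη2
    simp only [hη'] at h
    simp only [hη, hexp] at h
    rw [Measure.integral_comp_mul_left (fun r => |χ r| ^ p),
      Measure.integral_comp_mul_left (fun r => |-(1 / p) * χ r + ε * deriv χ r| ^ p),
      smul_eq_mul, smul_eq_mul, mul_left_comm] at h
    exact le_of_mul_le_mul_left h (by positivity)
  have hJc : Continuous J := by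
    have hcont : Continuous (Function.uncurry fun ε r : ℝ =>
        |-(1 / p) * χ r + ε * deriv χ r| ^ p) := by
      have h1 : Continuous fun x : ℝ × ℝ => χ x.2 := χ.continuous.comp continuous_snd
      have h2 : Continuous fun x : ℝ × ℝ => deriv χ x.2 := hχ'c.comp continuous_snd
      exact ((continuous_const.mul h1).add (continuous_fst.mul h2)).abs.rpow_const
        fun _ => Or.inr hp0.le
    convert continuous_parametric_integral_of_continuous (μ := volume) hcont
      χ.hasCompactSupport using 1
    ext ε
    refine (setIntegral_eq_integral_of_forall_compl_eq_zero fun r hr => ?_).symm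
    have h1 : deriv χ r = 0 :=
      image_eq_zero_of_notMem_tsupport fun h => hr (closure_mono support_deriv_subset
        |>.trans (by rw [(isClosed_tsupport _).closure_eq]) h)
    rw [h1, image_eq_zero_of_notMem_tsupport hr]
    simp [zero_rpow hp0.ne']
  have hJ0 : J 0 = 1 / p ^ p * I := by
    simp only [hJ, hI, ← integral_const_mul]
    congr 1 with r
    rw [zero_mul, add_zero, abs_mul, mul_rpow (abs_nonneg _) (abs_nonneg _), abs_neg,
      abs_of_pos (by positivity), div_rpow zero_le_one hp0.le, one_rpow]
  have hle : κ * I ≤ J 0 :=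
    ge_of_tendsto (hJc.tendsto 0 |>.mono_left (nhdsWithin_le_nhds (s := Ioi 0)))
      (eventually_mem_nhdsWithin.mono fun ε hε => key ε hε)
  have hI0 : 0 < I := by
    have hc : Continuous fun r => |χ r| ^ p :=
      χ.continuous.abs.rpow_const fun _ => Or.inr hp0.le
    refine hc.integral_pos_of_hasCompactSupport_nonneg_nonzero
      (HasCompactSupport.intro χ.hasCompactSupport fun r hr => ?_) (fun r => by positivity)
      (x := 0) ?_
    · rw [image_eq_zero_of_notMem_tsupport hr, abs_zero, zero_rpow hp0.ne']
    · have h1 : χ 0 = 1 := χ.one_of_mem_closedBall (by simp [χ])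
      simp [h1]
  rw [hJ0] at hle
  exact le_of_mul_le_mul_right hle hI0

end WeightedLine

/-- another critical Hardy inequality on the whole Grushin space, with sharp
constant `1/p^p` (Theorem 3.4 of the paper). -/
theorem another_critical_hardy
    (n : ℕ) (Q : ℝ) (hQ : Q = n + 2) (hQ3 : 3 ≤ Q) (p : ℝ) (hp : 1 < p) :
    (∀ u : GPt n → ℝ, IsTest {z : GPt n | z ≠ 0} u →
      (∫ z : GPt n, |Real.log (gNorm z)| ^ p *
          (gPsi z ^ (p / 2) * |radialDeriv u z| ^ p) / gNorm z ^ (Q - p))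
        ≥ 1 / p ^ p * ∫ z : GPt n, |u z| ^ p * gPsi z ^ (p / 2) / gNorm z ^ Q)
    ∧ ∀ κ : ℝ,
        (∀ u : GPt n → ℝ, IsTest {z : GPt n | z ≠ 0} u →
          (∫ z : GPt n, |Real.log (gNorm z)| ^ p *
              (gPsi z ^ (p / 2) * |radialDeriv u z| ^ p) / gNorm z ^ (Q - p))
            ≥ κ * ∫ z : GPt n, |u z| ^ p * gPsi z ^ (p / 2) / gNorm z ^ Q) →
        κ ≤ 1 / p ^ p := by
  subst hQ
  have hp0 : 0 < p := by linarith
  have hn : 1 ≤ n := by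
    have : (1 : ℝ) ≤ n := by linarith
    exact_mod_cast this
  have hrhs : ∀ u : GPt n → ℝ,
      ∫ z : GPt n, |u z| ^ p * gPsi z ^ (p / 2) / gNorm z ^ ((n : ℝ) + 2) =
        ∫ z, |u z| ^ p ∂gMeasure n p := fun u => by
    rw [integral_gMeasure]
    congr 1 with z
    rw [gWeight]
    ring
  refine ⟨fun u hu => ?_, fun κ H => le_of_weighted_line_hardy hp fun η hη hc => ?_⟩
  · have hu1 : ContDiff ℝ 1 u := hu.1.of_le (by exact_mod_cast le_top)
    rw [integral_radialDeriv hp0 (hu1.differentiable one_ne_zero), hrhs, ge_iff_le, one_div,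
      inv_mul_le_iff₀ (rpow_pos_of_pos hp0 p)]
    exact hardy_eulerDeriv hp hu1 hu.2.1 hu.2.2
  · obtain ⟨R, hR⟩ := hc.isCompact.isBounded.subset_closedBall 0
    have hR' : ∀ r, R < |r| → η r = 0 := fun r hr =>
      image_eq_zero_of_notMem_tsupport fun h =>
        (mem_closedBall_zero_iff.1 (hR h)).not_gt (by simpa using hr)
    have hηd : Differentiable ℝ η := hη.differentiable (by simp)
    have hu := isTest_logLogRadial (n := n) hη hR'
    have h := H _ hu
    obtain ⟨c, hc0, hlog⟩ := integral_abs_rpow_logLog (n := n) hn hp0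
    rw [integral_radialDeriv hp0 (hu.1.differentiable (by simp)), hrhs] at h
    simp only [log_mul_eulerDeriv_logLogRadial hηd hR'] at h
    rw [hlog _ (measurable_deriv η), ge_iff_le] at h
    have h2 := hlog η hη.continuous.measurable
    simp only [logLogRadial] at h
    rw [h2, mul_left_comm] at h
    exact le_of_mul_le_mul_left h hc0
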